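/- arXiv:1702.06431 — 3 statements merged into one kernel-verified Lean document; each statement's English description precedes it below -/
import Mathlib

section
/- Let n ≥ 1, let (m_i)_{1≤i≤n} and (m_{ij})_{1≤i<j≤n} be real numbers satisfying fracturedness, and let ħ₁ > ħ₂ > ⋯ > ħₙ > 0 be reals. Put M_i := m_i + ∑_{j>i} m_{ij}, and for a tuple (k_{ij})_{1≤i<j≤n} of natural numbers put E_i := m_i + ∑_{j>i}(m_{ij} − k_{ij}) + ∑_{j<i} k_{ji}. Then (2πi)^{−n} ∫_{[0,2π]ⁿ} ∏_{i=1}^n ( i ħᵢ e^{i tᵢ} · ħᵢ^{M_i} e^{i M_i tᵢ} ) · ∏_{i<j} (1 − (ħⱼ/ħᵢ) e^{i(tⱼ − tᵢ)})^{m_{ij}} dt₁⋯dtₙ = ∑_{(k_{ij})} ∏_{i=1}^n ħᵢ^{E_i + 1} · (e^{2πi E_i} − 1)/(2πi(E_i + 1)) · ∏_{i<j} (−1)^{k_{ij}} binom(m_{ij}, k_{ij}), where w^{m} := exp(m · Log w) uses the principal branch of the logarithm (well-defined since Re(1 − (ħⱼ/ħᵢ)e^{iθ}) > 0 for ħⱼ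 < ħᵢ), and where the series on the right converges absolutely. -/
open MeasureTheory
open scoped Classical

/-- The formal residue coefficient `Res(m)`. -/
noncomputable def Res (m : ℝ) : ℂ :=
  if m = -1 then 1
  else if ∃ z : ℤ, (z : ℝ) = m then 0
  else (Complex.exp (2 * Real.pi * Complex.I * ((m : ℂ) + 1)) - 1) /
    (2 * Real.pi * Complex.I * ((m : ℂ) + 1))

/-- Generalized binomial coefficient `binom(m, k)` for a real `m`. -/
noncomputable def gbinom (m : ℝ) (k : ℕ) : ℝ :=
  (∏ i ∈ Finset.range k, (m - i)) / (Nat.factorial k)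

/-- Upper-triangular index pairs `i < j` in `Fin n`. -/
abbrev UT (n : ℕ) := {p : Fin n × Fin n // p.1 < p.2}

/-- The exponent `E_i = m_i + ∑_{j>i}(m_{ij} - k_{ij}) + ∑_{j<i} k_{ji}`. -/
noncomputable def Eexp (n : ℕ) (m : Fin n → ℝ) (mm : Fin n → Fin n → ℝ)
    (K : UT n → ℕ) (i : Fin n) : ℝ :=
  m i + (∑ p : UT n, (if p.1.1 = i then mm p.1.1 p.1.2 - K p else 0))
      + ∑ p : UT n, (if p.1.2 = i then (K p : ℝ) else 0)

/-- One term of the series defining the quantum monodromy number `F₋`. -/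
noncomputable def FminusTerm (n : ℕ) (m : Fin n → ℝ) (mm : Fin n → Fin n → ℝ)
    (K : UT n → ℕ) : ℂ :=
  (∏ i : Fin n, Res (Eexp n m mm K i)) *
    ∏ p : UT n, ((-1 : ℂ) ^ K p * (gbinom (mm p.1.1 p.1.2) (K p) : ℂ))

/-- The quantum monodromy number `F₋((m_i, m_{ij})_{ij})`. -/
noncomputable def Fminus (n : ℕ) (m : Fin n → ℝ) (mm : Fin n → Fin n → ℝ) : ℂ :=
  ∑' K : UT n → ℕ, FminusTerm n m mm K

/-- The simplex `1 ≥ z₁ > ⋯ > zₙ ≥ 0`. -/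
def simplexSet (n : ℕ) : Set (Fin n → ℝ) :=
  {z | (∀ i, 0 ≤ z i ∧ z i ≤ 1) ∧ ∀ i j : Fin n, i < j → z j < z i}

/-- The generalized Selberg integral `Sel((m_i; m̄_i; m_{ij}))`. -/
noncomputable def Sel (n : ℕ) (m mbar : Fin n → ℝ) (mm : Fin n → Fin n → ℝ) : ℝ :=
  ∫ z in simplexSet n,
    (∏ i, z i ^ m i) * (∏ i, (1 - z i) ^ mbar i) *
      ∏ p : UT n, (z p.1.1 - z p.1.2) ^ mm p.1.1 p.1.2

/-- The shuffles `S_{k, \overline{n-k}}`: increasing on the first `k` positions,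
decreasing on the remaining positions (0-indexed). -/
def SbarFinset (n k : ℕ) : Finset (Equiv.Perm (Fin n)) :=
  Finset.univ.filter (fun η =>
    (∀ i j : Fin n, i < j → (j : ℕ) < k → η i < η j) ∧
    (∀ i j : Fin n, i < j → k ≤ (i : ℕ) → η j < η i))

/-- The inversion number `ℓ(η)` of a permutation. -/
def invNum {n : ℕ} (η : Equiv.Perm (Fin n)) : ℕ :=
  (Finset.univ.filter (fun p : Fin n × Fin n => p.1 < p.2 ∧ η p.2 < η p.1)).card

/-- The reduced quantum monodromy number `F̃₋((m_i; m_{ij}))`. -/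
noncomputable def Ftilde (n : ℕ) (m : Fin n → ℝ) (mm : Fin n → Fin n → ℝ) : ℂ :=
  (2 * Real.pi * Complex.I)⁻¹ ^ n *
    ∑ k ∈ Finset.range (n + 1), (-1 : ℂ) ^ k *
      (∏ i ∈ Finset.univ.filter (fun i : Fin n => k ≤ (i : ℕ)),
        Complex.exp (2 * Real.pi * Complex.I * (m i))) *
      ∑ η ∈ SbarFinset n k,
        (∏ p ∈ Finset.univ.filter
            (fun p : Fin n × Fin n => p.1 < p.2 ∧ η p.2 < η p.1),
          Complex.exp (Real.pi * Complex.I * (mm p.1 p.2))) *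
        (Sel n (fun i => m (η⁻¹ i)) (fun _ => 0) (fun i j => mm (η⁻¹ i) (η⁻¹ j)) : ℂ)

/-- The braiding factor `q(σ) = exp(πi ∑_{i<j, σ(i)>σ(j)} m_{ij})`. -/
noncomputable def qfac {n : ℕ} (mm : Fin n → Fin n → ℝ) (σ : Equiv.Perm (Fin n)) : ℂ :=
  Complex.exp (Real.pi * Complex.I *
    (∑ p ∈ Finset.univ.filter (fun p : Fin n × Fin n => p.1 < p.2 ∧ σ p.2 < σ p.1),
      (mm p.1 p.2 : ℂ)))

/-- The Euler Beta function as a real integral. -/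
noncomputable def Beta (x y : ℝ) : ℝ :=
  ∫ t in (0:ℝ)..1, t ^ (x - 1) * (1 - t) ^ (y - 1)

/-- The series term on the right-hand side of Step 1 of the main theorem:
`∏_i hbarᵢ^{E_i+1}·(e^{2πi E_i}−1)/(2πi(E_i+1)) · ∏_{i<j} (−1)^{k_{ij}} binom(m_{ij},k_{ij})`. -/
noncomputable def stepOneTerm (n : ℕ) (m : Fin n → ℝ) (mm : Fin n → Fin n → ℝ)
    (hbar : Fin n → ℝ) (K : UT n → ℕ) : ℂ :=
  (∏ i : Fin n,
      ((hbar i ^ (Eexp n m mm K i + 1) : ℝ) : ℂ) *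
        ((Complex.exp (2 * Real.pi * Complex.I * (Eexp n m mm K i)) - 1) /
          (2 * Real.pi * Complex.I * ((Eexp n m mm K i : ℂ) + 1)))) *
    ∏ p : UT n, ((-1 : ℂ) ^ K p * (gbinom (mm p.1.1 p.1.2) (K p) : ℂ))

theorem HasSum.mul_of_summable_norm {R α β : Type*} [NormedCommRing R] [CompleteSpace R]
    {f : α → R} {g : β → R} {s t : R} (hf : HasSum f s) (hg : HasSum g t)
    (hf' : Summable fun k => ‖f k‖) (hg' : Summable fun k => ‖g k‖) :
    HasSum (fun x : α × β => f x.1 * g x.2) (s * t) :=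
  hf.mul hg (summable_mul_of_summable_norm hf' hg')

theorem hasSum_fin_prod_pi {R κ : Type*} [NormedCommRing R] [CompleteSpace R] {n : ℕ}
    (f : Fin n → κ → R) (s : Fin n → R) (hf : ∀ i, HasSum (f i) (s i))
    (hf' : ∀ i, Summable fun k => ‖f i k‖) :
    HasSum (fun K : Fin n → κ => ∏ i, f i (K i)) (∏ i, s i) ∧
      Summable fun K : Fin n → κ => ‖∏ i, f i (K i)‖ := by
  induction n with
  | zero => simpa using (hasSum_fintype fun _ : Fin 0 → κ => ‖(1 : R)‖).summable
  | succ n ih =>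
    have h := ih (fun i => f i.succ) (fun i => s i.succ) (fun i => hf i.succ) fun i => hf' i.succ
    have hmul := (hf 0).mul_of_summable_norm h.1 (hf' 0) h.2
    have hnorm := (hf' 0).mul_norm h.2
    have key (x : κ × (Fin n → κ)) : ∏ i, f i (Fin.consEquiv (fun _ => κ) x i) =
        f 0 x.1 * ∏ i : Fin n, f i.succ (x.2 i) := by
      simp [Fin.prod_univ_succ, Fin.consEquiv]
    rw [Fin.prod_univ_succ, ← (Fin.consEquiv fun _ => κ).hasSum_iff,
      ← (Fin.consEquiv fun _ => κ).summable_iff]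
    simp only [Function.comp_def, key]
    exact ⟨hmul, hnorm⟩

/-- The product of finitely many absolutely summable series, indexed by tuples. -/
theorem hasSum_fintype_prod_pi {R ι κ : Type*} [NormedCommRing R] [CompleteSpace R] [Fintype ι]
    (f : ι → κ → R) (s : ι → R) (hf : ∀ i, HasSum (f i) (s i))
    (hf' : ∀ i, Summable fun k => ‖f i k‖) :
    HasSum (fun K : ι → κ => ∏ i, f i (K i)) (∏ i, s i) := by
  have e := (Fintype.equivFin ι).symm
  have h := (hasSum_fin_prod_pi (fun i => f (e i)) (fun i => s (e i)) (fun i => hf (e i))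
    fun i => hf' (e i)).1
  have key (K : Fin (Fintype.card ι) → κ) :
      ∏ b, f b (Equiv.arrowCongr e (Equiv.refl κ) K b) = ∏ a, f (e a) (K a) := by
    rw [← Equiv.prod_comp e]
    simp
  rw [Equiv.prod_comp e s] at h
  rw [← (Equiv.arrowCongr e (Equiv.refl κ)).hasSum_iff]
  simp only [Function.comp_def, key]
  exact h

theorem gbinom_eq_choose (a : ℝ) (k : ℕ) : gbinom a k = Ring.choose a k := by
  rw [Ring.choose_eq_smul, gbinom, ← Polynomial.aeval_eq_smeval, Polynomial.aeval_def,
    ← Polynomial.eval_map, algebraMap_int_eq, descPochhammer_map,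
    descPochhammer_eval_eq_prod_range, smul_eq_mul, div_eq_inv_mul]

/-- The binomial series for `(1 - z) ^ a` in the open unit disc. -/
theorem hasSum_one_sub_cpow (a : ℝ) {z : ℂ} (hz : ‖z‖ < 1) :
    HasSum (fun k : ℕ => (-1 : ℂ) ^ k * (gbinom a k : ℂ) * z ^ k) ((1 - z) ^ (a : ℂ)) := by
  have h := (Complex.one_add_cpow_hasFPowerSeriesOnBall_zero (a := (a : ℂ))).hasSum
    (y := -z) (by rw [← ENNReal.ofReal_one, Metric.eball_ofReal]; simpa using hz)
  rw [zero_add, ← sub_eq_add_neg] at h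
  refine h.congr_fun fun k => ?_
  rw [binomialSeries_apply, gbinom_eq_choose, Complex.ofReal_choose, List.ofFn_const,
    List.prod_replicate, smul_eq_mul, neg_pow z]
  ring

theorem sum_upper_eq_sum_filter {n : ℕ} (g : Fin n → Fin n → ℝ) (i : Fin n) :
    ∑ p : UT n, (if p.1.1 = i then g p.1.1 p.1.2 else 0) =
      ∑ j ∈ Finset.univ.filter (fun j => i < j), g i j := by
  rw [← Finset.sum_subtype (Finset.univ.filter fun p : Fin n × Fin n => p.1 < p.2) (by simp)
    (fun p : Fin n × Fin n => if p.1 = i then g p.1 p.2 else 0), Finset.sum_filter,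
    Fintype.sum_prod_type, Finset.sum_filter, Finset.sum_comm]
  refine Finset.sum_congr rfl fun j _ => ?_
  rw [Finset.sum_eq_single i (fun k _ hk => by simp [hk]) (by simp)]
  simp

theorem Eexp_eq {n : ℕ} (m : Fin n → ℝ) (mm : Fin n → Fin n → ℝ) (K : UT n → ℕ) (i : Fin n) :
    Eexp n m mm K i = (m i + ∑ j ∈ Finset.univ.filter (fun j => i < j), mm i j)
      + ∑ p : UT n, (K p : ℝ) *
        ((if p.1.2 = i then 1 else 0) - (if p.1.1 = i then 1 else 0)) := by
  rw [Eexp, ← sum_upper_eq_sum_filter, add_assoc, add_assoc, ← Finset.sum_add_distrib,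
    ← Finset.sum_add_distrib]
  congr 1
  refine Finset.sum_congr rfl fun p _ => ?_
  split_ifs <;> ring

/-- The exponents `E_i` differ from the leading exponents by integers. -/
theorem Eexp_add_one_ne_zero {n : ℕ} {m : Fin n → ℝ} {mm : Fin n → Fin n → ℝ} {i : Fin n}
    (hfrac : ¬ ∃ z : ℤ, (z : ℝ) = m i + ∑ j ∈ Finset.univ.filter (fun j => i < j), mm i j)
    (K : UT n → ℕ) : Eexp n m mm K i + 1 ≠ 0 := by
  intro h
  refine hfrac ⟨-1 - ∑ p : UT n, (K p : ℤ) *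
        ((if p.1.2 = i then 1 else 0) - (if p.1.1 = i then 1 else 0)), ?_⟩
  rw [Eexp_eq] at h
  push_cast
  linarith

theorem sum_Eexp_add_one_mul {n : ℕ} (m : Fin n → ℝ) (mm : Fin n → Fin n → ℝ) (K : UT n → ℕ)
    (v : Fin n → ℂ) :
    ∑ i, ((Eexp n m mm K i : ℂ) + 1) * v i =
      ∑ i, (((m i + ∑ j ∈ Finset.univ.filter (fun j => i < j), mm i j : ℝ) : ℂ) + 1) * v i +
        ∑ p : UT n, (K p : ℂ) * (v p.1.2 - v p.1.1) := by
  have h (i : Fin n) : ((Eexp n m mm K i : ℂ) + 1) * v i =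
      (((m i + ∑ j ∈ Finset.univ.filter (fun j => i < j), mm i j : ℝ) : ℂ) + 1) * v i +
        ∑ p : UT n, (K p : ℂ) *
          ((if p.1.2 = i then v i else 0) - (if p.1.1 = i then v i else 0)) := by
    rw [Eexp_eq, Complex.ofReal_add, add_right_comm, add_mul, Complex.ofReal_sum, Finset.sum_mul]
    congr 1
    refine Finset.sum_congr rfl fun p _ => ?_
    split_ifs <;> push_cast <;> ring
  simp_rw [h, Finset.sum_add_distrib]
  rw [Finset.sum_comm (s := Finset.univ (α := Fin n))]
  simp [← Finset.mul_sum, Finset.sum_sub_distrib]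

theorem integral_Icc_exp_I_mul {E : ℝ} (hE : E + 1 ≠ 0) :
    ∫ t in Set.Icc (0 : ℝ) (2 * Real.pi), Complex.exp (Complex.I * ((E : ℂ) + 1) * t) =
      (Complex.exp (2 * Real.pi * Complex.I * E) - 1) / (Complex.I * ((E : ℂ) + 1)) := by
  have hE' : (E : ℂ) + 1 ≠ 0 := by exact_mod_cast hE
  rw [integral_Icc_eq_integral_Ioc, ← intervalIntegral.integral_of_le (by positivity),
    integral_exp_mul_complex (mul_ne_zero Complex.I_ne_zero hE')]
  congr 1
  simp only [Complex.ofReal_zero, mul_zero, Complex.exp_zero]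
  congr 1
  rw [← Complex.exp_periodic (2 * Real.pi * Complex.I * E)]
  congr 1
  push_cast
  ring

theorem ofReal_rpow_mul_exp_I_mul {h : ℝ} (hh : 0 < h) (a t : ℝ) :
    ((h ^ a : ℝ) : ℂ) * Complex.exp (Complex.I * a * t) =
      Complex.exp (a * ((Real.log h : ℂ) + Complex.I * t)) := by
  rw [Real.rpow_def_of_pos hh, Complex.ofReal_exp, ← Complex.exp_add]
  congr 1
  push_cast
  ring

/-- The expanded integrand is a scalar multiple of a product of one-variable functions. -/
theorem expanded_integrand_eq {n : ℕ} (m : Fin n → ℝ) (mm : Fin n → Fin n → ℝ)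
    {hbar : Fin n → ℝ} (hpos : ∀ i, 0 < hbar i) (K : UT n → ℕ) (c : UT n → ℂ) (t : Fin n → ℝ) :
    (∏ i : Fin n,
        Complex.I * (hbar i : ℂ) * Complex.exp (Complex.I * (t i)) *
          ((hbar i ^ (m i + ∑ j ∈ Finset.univ.filter (fun j => i < j), mm i j) : ℝ) : ℂ) *
          Complex.exp (Complex.I *
            ((m i + ∑ j ∈ Finset.univ.filter (fun j => i < j), mm i j : ℝ) : ℂ) * (t i))) *
      ∏ p : UT n, (c p * (((hbar p.1.2 / hbar p.1.1 : ℝ) : ℂ) *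
        Complex.exp (Complex.I * ((t p.1.2 : ℂ) - (t p.1.1 : ℂ)))) ^ K p) =
    (∏ p, c p) * ∏ i, (Complex.I * ((hbar i ^ (Eexp n m mm K i + 1) : ℝ) : ℂ) *
      Complex.exp (Complex.I * ((Eexp n m mm K i : ℂ) + 1) * t i)) := by
  set v : Fin n → ℂ := fun i => (Real.log (hbar i) : ℂ) + Complex.I * t i with hv
  have hexp (i : Fin n) : (hbar i : ℂ) * Complex.exp (Complex.I * t i) = Complex.exp (v i) := by
    simpa using ofReal_rpow_mul_exp_I_mul (hpos i) 1 (t i)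
  have hG (i : Fin n) (M : ℝ) : Complex.I * (hbar i : ℂ) * Complex.exp (Complex.I * (t i)) *
      ((hbar i ^ M : ℝ) : ℂ) * Complex.exp (Complex.I * (M : ℂ) * (t i)) =
      Complex.I * Complex.exp (((M : ℂ) + 1) * v i) := by
    rw [add_mul, Complex.exp_add, ← ofReal_rpow_mul_exp_I_mul (hpos i), one_mul, ← hexp]
    ring
  have hE (i : Fin n) : Complex.I * ((hbar i ^ (Eexp n m mm K i + 1) : ℝ) : ℂ) *
      Complex.exp (Complex.I * ((Eexp n m mm K i : ℂ) + 1) * t i) =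
      Complex.I * Complex.exp (((Eexp n m mm K i : ℂ) + 1) * v i) := by
    have := ofReal_rpow_mul_exp_I_mul (hpos i) (Eexp n m mm K i + 1) (t i)
    rw [Complex.ofReal_add, Complex.ofReal_one] at this
    rw [mul_assoc, this]
  have hz (p : UT n) : ((hbar p.1.2 / hbar p.1.1 : ℝ) : ℂ) *
        Complex.exp (Complex.I * ((t p.1.2 : ℂ) - (t p.1.1 : ℂ))) =
      Complex.exp (v p.1.2 - v p.1.1) := by
    rw [Complex.exp_sub, ← hexp, ← hexp, mul_sub, Complex.exp_sub, Complex.ofReal_div,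
      div_mul_div_comm]
  simp_rw [hG, hE, hz, Finset.prod_mul_distrib, ← Complex.exp_nat_mul, ← Complex.exp_sum]
  rw [sum_Eexp_add_one_mul, Complex.exp_add]
  ring

/-- Step 1 of the proof of the main theorem: the lifted torus contour integral
`(2πi)^{−n} ∫_{[0,2π]ⁿ} ∏ᵢ (i hbarᵢ e^{i tᵢ} hbarᵢ^{Mᵢ} e^{i Mᵢ tᵢ}) ∏_{i<j}(1−(hbarⱼ/hbarᵢ)e^{i(tⱼ−tᵢ)})^{m_{ij}} dt`
equals the absolutely convergent series `∑_{(k_{ij})} ∏ᵢ hbarᵢ^{Eᵢ+1}(e^{2πiEᵢ}−1)/(2πi(Eᵢ+1)) ∏_{i<j}(−1)^{k_{ij}} binom(m_{ij},k_{ij})`,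
for `0 < hbarₙ < ⋯ < hbar₁` and fractured parameters. Powers of `1−(hbarⱼ/hbarᵢ)e^{iθ}` use the
principal branch (complex `cpow`). -/
theorem contour_integral_eq_series (n : ℕ) (hn : 1 ≤ n)
    (m : Fin n → ℝ) (mm : Fin n → Fin n → ℝ)
    (hfrac : ∀ i : Fin n,
      ¬ ∃ z : ℤ, (z : ℝ) = m i + ∑ j ∈ Finset.univ.filter (fun j => i < j), mm i j)
    (hbar : Fin n → ℝ) (hpos : ∀ i, 0 < hbar i) (hdec : ∀ i j : Fin n, i < j → hbar j < hbar i) :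
    Summable (fun K : UT n → ℕ => ‖stepOneTerm n m mm hbar K‖) ∧
    (2 * Real.pi * Complex.I)⁻¹ ^ n *
      (∫ t in Set.univ.pi (fun _ : Fin n => Set.Icc (0 : ℝ) (2 * Real.pi)),
        (∏ i : Fin n,
            Complex.I * (hbar i : ℂ) * Complex.exp (Complex.I * (t i)) *
              ((hbar i ^ (m i + ∑ j ∈ Finset.univ.filter (fun j => i < j), mm i j) : ℝ) : ℂ) *
              Complex.exp (Complex.I *
                ((m i + ∑ j ∈ Finset.univ.filter (fun j => i < j), mm i j : ℝ) : ℂ) * (t i))) *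
          ∏ p : UT n,
            ((1 : ℂ) - ((hbar p.1.2 / hbar p.1.1 : ℝ) : ℂ) *
                Complex.exp (Complex.I * ((t p.1.2 : ℂ) - (t p.1.1 : ℂ)))) ^
              ((mm p.1.1 p.1.2 : ℝ) : ℂ)) =
      ∑' K : UT n → ℕ, stepOneTerm n m mm hbar K := by
  have hdom (p : UT n) : 0 < hbar p.1.2 / hbar p.1.1 ∧ hbar p.1.2 / hbar p.1.1 < 1 :=
    ⟨div_pos (hpos _) (hpos _), (div_lt_one (hpos _)).2 (hdec _ _ p.2)⟩
  set S : Set (Fin n → ℝ) := Set.univ.pi (fun _ : Fin n => Set.Icc (0 : ℝ) (2 * Real.pi)) with hS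
  set G : (Fin n → ℝ) → ℂ := fun t => ∏ i : Fin n,
    Complex.I * (hbar i : ℂ) * Complex.exp (Complex.I * (t i)) *
      ((hbar i ^ (m i + ∑ j ∈ Finset.univ.filter (fun j => i < j), mm i j) : ℝ) : ℂ) *
      Complex.exp (Complex.I *
        ((m i + ∑ j ∈ Finset.univ.filter (fun j => i < j), mm i j : ℝ) : ℂ) * (t i)) with hG
  set z : UT n → (Fin n → ℝ) → ℂ := fun p t => ((hbar p.1.2 / hbar p.1.1 : ℝ) : ℂ) *
    Complex.exp (Complex.I * ((t p.1.2 : ℂ) - (t p.1.1 : ℂ))) with hz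
  set c : (UT n → ℕ) → UT n → ℂ :=
    fun K p => (-1 : ℂ) ^ K p * (gbinom (mm p.1.1 p.1.2) (K p) : ℂ) with hc
  have hznorm (p : UT n) (t : Fin n → ℝ) : ‖z p t‖ = hbar p.1.2 / hbar p.1.1 := by
    rw [hz, norm_mul, mul_comm Complex.I, ← Complex.ofReal_sub, Complex.norm_exp_ofReal_mul_I,
      mul_one, Complex.norm_real, Real.norm_of_nonneg (hdom p).1.le]
  have hGnorm (t : Fin n → ℝ) : ‖G t‖ = ‖G 0‖ := by
    simp only [hG, norm_prod, norm_mul, Complex.norm_exp]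
    simp
  have hseries (t : Fin n → ℝ) : HasSum (fun K : UT n → ℕ => G t * ∏ p, (c K p * z p t ^ K p))
      (G t * ∏ p : UT n, (1 - z p t) ^ ((mm p.1.1 p.1.2 : ℝ) : ℂ)) := by
    have hbin (p : UT n) := hasSum_one_sub_cpow (mm p.1.1 p.1.2)
      ((hznorm p t).trans_lt (hdom p).2)
    have h := hasSum_fintype_prod_pi
      (fun (p : UT n) (k : ℕ) => (-1 : ℂ) ^ k * (gbinom (mm p.1.1 p.1.2) k : ℂ) * z p t ^ k)
      (fun p => (1 - z p t) ^ ((mm p.1.1 p.1.2 : ℝ) : ℂ)) hbin fun p => (hbin p).summable.norm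
    exact h.mul_left (G t)
  have hint : HasSum (fun K : UT n → ℕ => ∫ t in S, G t * ∏ p, (c K p * z p t ^ K p))
      (∫ t in S, G t * ∏ p : UT n, (1 - z p t) ^ ((mm p.1.1 p.1.2 : ℝ) : ℂ)) := by
    have hSfin : IsFiniteMeasure ((volume : Measure (Fin n → ℝ)).restrict S) :=
      isFiniteMeasure_restrict.2 (isCompact_univ_pi fun _ => isCompact_Icc).measure_lt_top.ne
    refine hasSum_integral_of_dominated_convergence
      (fun K _ => ‖G 0 * ∏ p, (c K p * z p 0 ^ K p)‖) (fun K => ?_) (fun K => ?_) ?_ ?_ ?_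
    · exact Continuous.aestronglyMeasurable (by fun_prop)
    · refine ae_of_all _ fun t => le_of_eq ?_
      simp only [norm_mul, norm_prod, norm_pow, hznorm, hGnorm t]
    · exact ae_of_all _ fun _ => (hseries 0).summable.norm
    · exact integrable_const _
    · exact ae_of_all _ hseries
  have hterm (K : UT n → ℕ) : (2 * Real.pi * Complex.I)⁻¹ ^ n *
      ∫ t in S, G t * ∏ p, (c K p * z p t ^ K p) = stepOneTerm n m mm hbar K := by
    simp_rw [hG, hz, expanded_integrand_eq m mm hpos]
    rw [integral_const_mul, hS, volume_pi, Measure.restrict_pi_pi,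
      integral_fintype_prod_eq_prod (fun (i : Fin n) (x : ℝ) =>
        Complex.I * ((hbar i ^ (Eexp n m mm K i + 1) : ℝ) : ℂ) *
        Complex.exp (Complex.I * ((Eexp n m mm K i : ℂ) + 1) * x))]
    have hconst : (2 * Real.pi * Complex.I)⁻¹ ^ n = ∏ _i : Fin n, (2 * Real.pi * Complex.I)⁻¹ := by
      simp
    rw [hconst, mul_left_comm, ← Finset.prod_mul_distrib, mul_comm, stepOneTerm]
    congr 1
    refine Finset.prod_congr rfl fun i _ => ?_
    have hE := Eexp_add_one_ne_zero (hfrac i) K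
    have hE' : (Eexp n m mm K i : ℂ) + 1 ≠ 0 := by exact_mod_cast hE
    rw [integral_const_mul, integral_Icc_exp_I_mul hE]
    field_simp
  have hsum := hint.mul_left ((2 * Real.pi * Complex.I)⁻¹ ^ n)
  simp only [hterm] at hsum
  exact ⟨hsum.summable.norm, hsum.tsum_eq.symm⟩
end

section
/- Let n ≥ 1 and let (m_i)_{1≤i≤n}, (m_{ij})_{1≤i<j≤n} be real numbers with m_{ij} ≥ 0 for all i < j and satisfying fracturedness. Then the family indexed by tuples (k_{ij})_{1≤i<j≤n} of natural numbers with terms ∏_{i=1}^n Res(m_i + ∑_{j>i}(m_{ij} − k_{ij}) + ∑_{j<i} k_{ji}) · ∏_{i<j} (−1)^{k_{ij}} binom(m_{ij}, k_{ij}) is absolutely summable; in particular the quantum monodromy number F₋((m_i, m_{ij})_{ij}) is a well-defined complex number. -/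
open MeasureTheory
open scoped Classical

/-- The residue coefficients are bounded by one. -/
theorem norm_Res_le_one (m : ℝ) : ‖Res m‖ ≤ 1 := by
  unfold Res
  split_ifs with h1 h2
  · simp
  · simp
  · have h : (2 * Real.pi * Complex.I * ((m : ℂ) + 1)) =
        Complex.I * ((2 * Real.pi * (m + 1) : ℝ) : ℂ) := by
      push_cast
      ring
    rw [h, norm_div, norm_mul, Complex.norm_I, one_mul, Complex.norm_real]
    exact div_le_one_of_le₀ (Real.norm_exp_I_mul_ofReal_sub_one_le) (norm_nonneg _)

theorem succ_mul_gbinom_succ (m : ℝ) (k : ℕ) :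
    ((k : ℝ) + 1) * gbinom m (k + 1) = (m - k) * gbinom m k := by
  have hk : (Nat.factorial k : ℝ) ≠ 0 := by positivity
  have hk' : (k : ℝ) + 1 ≠ 0 := by positivity
  unfold gbinom
  rw [Finset.prod_range_succ, Nat.factorial_succ]
  push_cast
  field_simp

/-- Beyond the upper index, the absolute values of generalized binomial coefficients telescope. -/
theorem mul_abs_gbinom_eq_sub {m : ℝ} {k : ℕ} (hk : m ≤ k) :
    m * |gbinom m k| = k * |gbinom m k| - ((k + 1 : ℕ) : ℝ) * |gbinom m (k + 1)| := by
  have h := congrArg abs (succ_mul_gbinom_succ m k)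
  rw [abs_mul, abs_mul, abs_of_nonneg (by positivity : (0 : ℝ) ≤ (k : ℝ) + 1),
    abs_of_nonpos (sub_nonpos.mpr hk)] at h
  push_cast
  linarith

theorem summable_abs_gbinom {m : ℝ} (hm : 0 ≤ m) : Summable (fun k => |gbinom m k|) := by
  rcases hm.eq_or_lt with rfl | hm
  · refine summable_of_ne_finset_zero (s := {0}) fun k hk => ?_
    obtain ⟨j, rfl⟩ := Nat.exists_eq_succ_of_ne_zero (Finset.notMem_singleton.mp hk)
    simp [gbinom, Finset.prod_range_succ']
  · obtain ⟨N, hN⟩ := exists_nat_ge m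
    rw [← summable_nat_add_iff N, ← summable_mul_left_iff hm.ne']
    refine summable_of_sum_range_le (c := N * |gbinom m N|) (fun k => by positivity) fun M => ?_
    rw [Finset.sum_congr rfl fun k _ => mul_abs_gbinom_eq_sub (m := m) (k := k + N)
      (hN.trans (by push_cast; linarith [Nat.cast_nonneg (α := ℝ) k]))]
    have h := Finset.sum_range_sub' (fun k => ((k + N : ℕ) : ℝ) * |gbinom m (k + N)|) M
    simp only [Nat.add_right_comm _ 1 N, zero_add] at h
    rw [h]
    exact sub_le_self _ (by positivity)

/-- A finite product of nonnegative summable functions of separate variables is summable. -/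
theorem summable_prod_apply_of_nonneg {ι κ : Type*} [Fintype ι] {f : ι → κ → ℝ}
    (hf0 : ∀ i k, 0 ≤ f i k) (hf : ∀ i, Summable (f i)) :
    Summable (fun K : ι → κ => ∏ i, f i (K i)) := by
  refine summable_of_sum_le (c := ∏ i, ∑' k, f i k)
    (fun K => Finset.prod_nonneg fun i _ => hf0 i _) fun S => ?_
  calc ∑ K ∈ S, ∏ i, f i (K i)
      ≤ ∑ K ∈ Fintype.piFinset fun i => S.image (fun K => K i), ∏ i, f i (K i) :=
        Finset.sum_le_sum_of_subset_of_nonneg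
          (fun K hK => Fintype.mem_piFinset.mpr fun i => Finset.mem_image_of_mem _ hK)
          (fun K _ _ => Finset.prod_nonneg fun i _ => hf0 i _)
    _ = ∏ i, ∑ k ∈ S.image (fun K => K i), f i k := (Finset.prod_univ_sum _ _).symm
    _ ≤ ∏ i, ∑' k, f i k :=
        Finset.prod_le_prod (fun i _ => Finset.sum_nonneg fun k _ => hf0 i k)
          (fun i _ => (hf i).sum_le_tsum _ fun k _ => hf0 i k)

/-- Absolute summability of the series defining the quantum monodromy number `F₋`
when all `m_{ij} ≥ 0` and fracturedness holds; in particular `F₋` is a well-defined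
complex number. -/
theorem Fminus_summable (n : ℕ) (hn : 1 ≤ n)
    (m : Fin n → ℝ) (mm : Fin n → Fin n → ℝ)
    (hmm : ∀ i j : Fin n, i < j → 0 ≤ mm i j)
    (hfrac : ∀ i : Fin n,
      ¬ ∃ z : ℤ, (z : ℝ) = m i + ∑ j ∈ Finset.univ.filter (fun j => i < j), mm i j) :
    Summable (fun K : UT n → ℕ => ‖FminusTerm n m mm K‖) := by
  refine Summable.of_nonneg_of_le (fun K => norm_nonneg _) (fun K => ?_)
    (summable_prod_apply_of_nonneg (f := fun (p : UT n) k => |gbinom (mm p.1.1 p.1.2) k|)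
      (fun p k => abs_nonneg _) fun p => summable_abs_gbinom (hmm _ _ p.2))
  rw [FminusTerm, norm_mul, norm_prod, norm_prod]
  simp only [norm_mul, norm_pow, norm_neg, norm_one, one_pow, one_mul, Complex.norm_real,
    Real.norm_eq_abs]
  exact mul_le_of_le_one_left (Finset.prod_nonneg fun p _ => abs_nonneg _)
    (Finset.prod_le_one (fun i _ => norm_nonneg _) fun i _ => norm_Res_le_one _)
end

section
/- Let m₁, m₂, m₁₂ be real numbers with m₁ > −1, m₂ > −1, m₁₂ > −1, and m₁ + m₂ + m₁₂ + 2 > 0. Then the reduced quantum monodromy number for n = 2 satisfies F̃₋(m₁, m₂; m₁₂) = (1/(2πi)²) · [ (1 − e^{2πi m₂}) B(m₂+1, m₁₂+1) − e^{2πi m₂ + πi m₁₂} (1 − e^{2πi m₁}) B(m₁+1, m₁₂+1) ] / (m₁ + m₂ + m₁₂ + 2). -/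
open MeasureTheory
open scoped Classical

theorem intervalIntegrable_rpow_mul_one_sub_rpow {b c : ℝ} (hb : -1 < b) (hc : -1 < c) :
    IntervalIntegrable (fun t : ℝ => t ^ b * (1 - t) ^ c) volume 0 1 := by
  have h := Complex.betaIntegral_convergent (u := ((b + 1 : ℝ) : ℂ)) (v := ((c + 1 : ℝ) : ℂ))
    (by rw [Complex.ofReal_re]; linarith) (by rw [Complex.ofReal_re]; linarith)
  rw [intervalIntegrable_iff_integrableOn_Ioc_of_le zero_le_one] at h ⊢
  refine Integrable.congr h.re ?_
  filter_upwards [ae_restrict_mem measurableSet_Ioc] with t ht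
  have e : (t : ℂ) ^ (((b + 1 : ℝ) : ℂ) - 1) * (1 - (t : ℂ)) ^ (((c + 1 : ℝ) : ℂ) - 1)
      = ((t ^ b * (1 - t) ^ c : ℝ) : ℂ) := by
    rw [Complex.ofReal_mul, Complex.ofReal_cpow ht.1.le, Complex.ofReal_cpow (by linarith [ht.2])]
    push_cast
    simp
  simp only [e]
  exact Complex.ofReal_re _

theorem rpow_mul_sub_rpow_eq {b c x y : ℝ} (hx : 0 < x) (hy : 0 ≤ y) (hyx : y ≤ x) :
    y ^ b * (x - y) ^ c = x ^ (b + c) * ((y / x) ^ b * (1 - y / x) ^ c) := by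
  have h : x - y = x * (1 - y / x) := by field_simp
  have h' : 0 ≤ 1 - y / x := by
    rw [sub_nonneg, div_le_one hx]; exact hyx
  rw [h, Real.mul_rpow hx.le h', Real.div_rpow hy hx.le, Real.rpow_add hx]
  have := (Real.rpow_pos_of_pos hx b).ne'
  field_simp

theorem intervalIntegrable_rpow_mul_sub_rpow {b c x : ℝ} (hb : -1 < b) (hc : -1 < c)
    (hx : 0 < x) : IntervalIntegrable (fun y : ℝ => y ^ b * (x - y) ^ c) volume 0 x := by
  have h := ((intervalIntegrable_rpow_mul_one_sub_rpow hb hc).comp_mul_left (c := x⁻¹)).const_mul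
    (x ^ (b + c))
  rw [zero_div, one_div, inv_inv] at h
  rw [intervalIntegrable_iff_integrableOn_Ioc_of_le hx.le] at h ⊢
  refine h.congr_fun (fun y hy => ?_) measurableSet_Ioc
  rw [rpow_mul_sub_rpow_eq hx hy.1.le hy.2, div_eq_inv_mul]

theorem integral_rpow_mul_sub_rpow {b c x : ℝ} (hx : 0 < x) :
    ∫ y in (0 : ℝ)..x, y ^ b * (x - y) ^ c = x ^ (b + c + 1) * Beta (b + 1) (c + 1) := by
  have h : ∫ y in (0 : ℝ)..x, y ^ b * (x - y) ^ c
      = ∫ y in (0 : ℝ)..x, x ^ (b + c) * ((y / x) ^ b * (1 - y / x) ^ c) := by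
    refine intervalIntegral.integral_congr fun y hy => ?_
    rw [Set.uIcc_of_le hx.le] at hy
    exact rpow_mul_sub_rpow_eq hx hy.1 hy.2
  rw [h, intervalIntegral.integral_const_mul,
    intervalIntegral.integral_comp_div (fun t : ℝ => t ^ b * (1 - t) ^ c) hx.ne',
    zero_div, div_self hx.ne', Real.rpow_add_one hx.ne', Beta]
  simp only [add_sub_cancel_right, smul_eq_mul]
  ring

/-- The triangle `1 ≥ x > y ≥ 0`, with the larger coordinate first. -/
def triangle : Set (ℝ × ℝ) := {p | 0 ≤ p.2 ∧ p.2 < p.1 ∧ p.1 ≤ 1}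

theorem measurableSet_triangle : MeasurableSet triangle :=
  (measurableSet_le measurable_const measurable_snd).inter
    ((measurableSet_lt measurable_snd measurable_fst).inter
      (measurableSet_le measurable_fst measurable_const))

theorem indicator_triangle_slice (f : ℝ × ℝ → ℝ) (x : ℝ) :
    (fun y => triangle.indicator f (x, y)) =
      if x ∈ Set.Ioc (0 : ℝ) 1 then (Set.Ico 0 x).indicator (fun y => f (x, y)) else 0 := by
  funext y
  simp only [Set.indicator_apply, triangle, Set.mem_ofPred_eq, Set.mem_Ioc]
  split_ifs with h h' h'
  · exact (Set.indicator_of_mem (show y ∈ Set.Ico 0 x from ⟨h.1, h.2.1⟩) fun y => f (x, y)).symm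
  · exact absurd ⟨h.1.trans_lt h.2.1, h.2.2⟩ h'
  · exact (Set.indicator_of_notMem
      (show y ∉ Set.Ico 0 x from fun hy => h ⟨hy.1, hy.2, h'.2⟩) fun y => f (x, y)).symm
  · rfl

theorem integral_triangle {a b c : ℝ} (hb : -1 < b) (hc : -1 < c) (hs : 0 < a + b + c + 2) :
    ∫ p in triangle, p.1 ^ a * (p.2 ^ b * (p.1 - p.2) ^ c) =
      Beta (b + 1) (c + 1) / (a + b + c + 2) := by
  set f : ℝ × ℝ → ℝ := fun p => p.1 ^ a * (p.2 ^ b * (p.1 - p.2) ^ c) with hf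
  have hslice (x : ℝ) : Integrable (fun y => triangle.indicator f (x, y)) := by
    rw [indicator_triangle_slice]
    split_ifs with hx
    · rw [integrable_indicator_iff measurableSet_Ico, integrableOn_Ico_iff_integrableOn_Ioo,
        ← integrableOn_Ioc_iff_integrableOn_Ioo,
        ← intervalIntegrable_iff_integrableOn_Ioc_of_le hx.1.le]
      exact (intervalIntegrable_rpow_mul_sub_rpow hb hc hx.1).const_mul (x ^ a)
    · exact integrable_zero _ _ _
  have hint : (fun x => ∫ y, triangle.indicator f (x, y)) =
      (Set.Ioc (0 : ℝ) 1).indicator fun x => x ^ (a + b + c + 1) * Beta (b + 1) (c + 1) := by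
    funext x
    rw [indicator_triangle_slice, Set.indicator_apply]
    split_ifs with hx
    · rw [integral_indicator measurableSet_Ico, integral_Ico_eq_integral_Ioo,
        ← integral_Ioc_eq_integral_Ioo, ← intervalIntegral.integral_of_le hx.1.le]
      simp only [hf]
      rw [intervalIntegral.integral_const_mul, integral_rpow_mul_sub_rpow hx.1, ← mul_assoc,
        ← Real.rpow_add hx.1]
      ring_nf
    · simp
  have hnonneg (p : ℝ × ℝ) : 0 ≤ triangle.indicator f p := by
    refine Set.indicator_nonneg (fun p hp => ?_) p
    have h1 : 0 ≤ p.1 := hp.1.trans hp.2.1.le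
    have h2 : 0 ≤ p.1 - p.2 := sub_nonneg.2 hp.2.1.le
    exact mul_nonneg (Real.rpow_nonneg h1 _)
      (mul_nonneg (Real.rpow_nonneg hp.1 _) (Real.rpow_nonneg h2 _))
  have hmeas : Measurable (triangle.indicator f) :=
    Measurable.indicator (by fun_prop) measurableSet_triangle
  have hintegrable : Integrable (triangle.indicator f) (volume.prod volume) := by
    rw [integrable_prod_iff hmeas.aestronglyMeasurable]
    refine ⟨Filter.Eventually.of_forall hslice, ?_⟩
    simp only [Real.norm_of_nonneg (hnonneg _)]
    rw [hint, integrable_indicator_iff measurableSet_Ioc,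
      ← intervalIntegrable_iff_integrableOn_Ioc_of_le zero_le_one]
    exact (intervalIntegral.intervalIntegrable_rpow' (by linarith)).mul_const _
  rw [← integral_indicator measurableSet_triangle, Measure.volume_eq_prod,
    integral_prod _ hintegrable, hint, integral_indicator measurableSet_Ioc,
    ← intervalIntegral.integral_of_le zero_le_one, intervalIntegral.integral_mul_const,
    integral_rpow (Or.inl (by linarith)), Real.one_rpow, Real.zero_rpow (by linarith)]
  ring

theorem Sel_two (a b c : ℝ) (hb : -1 < b) (hc : -1 < c) (hs : 0 < a + b + c + 2) :
    Sel 2 ![a, b] (fun _ => 0) (fun _ _ => c) = Beta (b + 1) (c + 1) / (a + b + c + 2) := by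
  have hset : simplexSet 2 = MeasurableEquiv.finTwoArrow ⁻¹' triangle := by
    ext z
    simp only [simplexSet, triangle, Fin.forall_fin_two, Set.mem_ofPred_eq, Set.mem_preimage,
      MeasurableEquiv.finTwoArrow_apply]
    constructor
    · rintro ⟨⟨⟨_, h0⟩, h1, _⟩, h⟩
      exact ⟨h1, h.1.2 (by decide), h0⟩
    · rintro ⟨h1, h, h0⟩
      refine ⟨⟨⟨h1.trans h.le, h0⟩, h1, h.le.trans h0⟩, ⟨?_, ?_⟩, ?_, ?_⟩ <;> simp [h]
  let _ : Unique (UT 2) :=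
    { default := ⟨(0, 1), by decide⟩
      uniq := by decide }
  have hpair (g : UT 2 → ℝ) : ∏ p, g p = g ⟨(0, 1), by decide⟩ := Fintype.prod_unique g
  rw [← integral_triangle hb hc hs, Sel, hset,
    ← (volume_preserving_finTwoArrow ℝ).setIntegral_preimage_emb
      (MeasurableEquiv.measurableEmbedding _)]
  refine integral_congr_ae (Filter.Eventually.of_forall fun z => ?_)
  simp only [hpair]
  simp [mul_assoc]

theorem perm_fin_two (η : Equiv.Perm (Fin 2)) : η = 1 ∨ η = Equiv.swap 0 1 := by
  revert η; decide

theorem one_ne_swap_fin_two : (1 : Equiv.Perm (Fin 2)) ≠ Equiv.swap 0 1 := by decide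

theorem SbarFinset_two_zero : SbarFinset 2 0 = {Equiv.swap 0 1} := by
  ext η
  rcases perm_fin_two η with rfl | rfl <;>
    simp [SbarFinset, Fin.forall_fin_two, one_ne_swap_fin_two]

theorem SbarFinset_two_one : SbarFinset 2 1 = {1, Equiv.swap 0 1} := by
  ext η
  rcases perm_fin_two η with rfl | rfl <;> simp [SbarFinset, Fin.forall_fin_two]

theorem SbarFinset_two_two : SbarFinset 2 2 = {1} := by
  ext η
  rcases perm_fin_two η with rfl | rfl <;> simp [SbarFinset, Fin.forall_fin_two]

theorem inversions_one :
    Finset.univ.filter (fun p : Fin 2 × Fin 2 => p.1 < p.2 ∧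
      (1 : Equiv.Perm (Fin 2)) p.2 < (1 : Equiv.Perm (Fin 2)) p.1) = ∅ :=
  Finset.filter_eq_empty_iff.2 fun _ _ h => lt_asymm h.1 h.2

theorem inversions_swap :
    Finset.univ.filter (fun p : Fin 2 × Fin 2 => p.1 < p.2 ∧
      Equiv.swap (0 : Fin 2) 1 p.2 < Equiv.swap (0 : Fin 2) 1 p.1) = {(0, 1)} := by
  ext ⟨i, j⟩
  fin_cases i <;> fin_cases j <;> simp

/-- Example 5.3 (`exm_F2`): the reduced quantum monodromy number for `n = 2` equals
`(2πi)⁻² [(1−e^{2πim₂})B(m₂+1,m₁₂+1) − e^{2πim₂+πim₁₂}(1−e^{2πim₁})B(m₁+1,m₁₂+1)]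
/(m₁+m₂+m₁₂+2)`. -/
theorem Ftilde_two_eq_beta (m₁ m₂ m₁₂ : ℝ)
    (h1 : -1 < m₁) (h2 : -1 < m₂) (h12 : -1 < m₁₂) (hsum : 0 < m₁ + m₂ + m₁₂ + 2) :
    Ftilde 2 ![m₁, m₂] (fun _ _ => m₁₂) =
      (1 / (2 * Real.pi * Complex.I) ^ 2) *
        (((1 - Complex.exp (2 * Real.pi * Complex.I * m₂)) * (Beta (m₂ + 1) (m₁₂ + 1) : ℂ) -
            Complex.exp (2 * Real.pi * Complex.I * m₂ + Real.pi * Complex.I * m₁₂) *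
              (1 - Complex.exp (2 * Real.pi * Complex.I * m₁)) *
              (Beta (m₁ + 1) (m₁₂ + 1) : ℂ)) /
          ((m₁ : ℂ) + m₂ + m₁₂ + 2)) := by
  have hid : (fun i => ![m₁, m₂] ((1 : Equiv.Perm (Fin 2))⁻¹ i)) = ![m₁, m₂] := by simp
  have hswap : (fun i => ![m₁, m₂] ((Equiv.swap (0 : Fin 2) 1)⁻¹ i)) = ![m₂, m₁] := by
    funext i; fin_cases i <;> simp
  have hk0 : Finset.univ.filter (fun i : Fin 2 => 0 ≤ (i : ℕ)) = {0, 1} := by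
    ext i; fin_cases i <;> simp
  have hk1 : Finset.univ.filter (fun i : Fin 2 => 1 ≤ (i : ℕ)) = {1} := by
    ext i; fin_cases i <;> simp
  have hk2 : Finset.univ.filter (fun i : Fin 2 => 2 ≤ (i : ℕ)) = ∅ := by
    ext i; fin_cases i <;> simp
  have hs : ((m₁ : ℂ) + m₂ + m₁₂ + 2) ≠ 0 := by exact_mod_cast hsum.ne'
  rw [Ftilde]
  simp only [Finset.sum_range_succ, Finset.sum_range_zero, SbarFinset_two_zero,
    SbarFinset_two_one, SbarFinset_two_two, Finset.sum_singleton, Finset.sum_pair one_ne_swap_fin_two,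
    inversions_one, inversions_swap, hid, hswap, hk0, hk1, hk2,
    Sel_two m₁ m₂ m₁₂ h2 h12 hsum, Sel_two m₂ m₁ m₁₂ h1 h12 (by linarith)]
  rw [add_comm m₂ m₁, Finset.prod_pair (by decide), Complex.exp_add]
  simp only [Finset.prod_singleton, Finset.prod_empty, Matrix.cons_val_zero, Matrix.cons_val_one]
  push_cast
  field_simp
  ring
end
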